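/- arXiv:math/0211424 — 3 statements merged into one kernel-verified Lean document; each statement's English description precedes it below -/
import Mathlib

section
/- Let n ≥ 2 be an integer and λ₁, …, λ_{n+1} ∈ [0, π]. Then the identity matrix I belongs to the set product C(λ₁)⋯C(λ_{n+1}) in SU(2) if and only if for every integer j with 0 ≤ j ≤ n/2 and every choice of signs ε₁, …, ε_{n+1} ∈ {+1, −1} with exactly n − 2j of the ε_i equal to −1, one has ∑_{i=1}^{n+1} ε_i λ_i ≤ 2jπ. -/
open Matrix Complex Pointwise

/-- `SU(2)`: the subgroup of the unitary group `U(2)` (2×2 complex unitary matrices)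
consisting of the matrices of determinant 1. -/
noncomputable def SU2 : Subgroup (Matrix.unitaryGroup (Fin 2) ℂ) :=
  MonoidHom.ker (Matrix.detMonoidHom.comp (Submonoid.subtype _))

theorem mem_SU2_iff (A : Matrix.unitaryGroup (Fin 2) ℂ) :
    A ∈ SU2 ↔ Matrix.det (A : Matrix (Fin 2) (Fin 2) ℂ) = 1 := Iff.rfl

/-- The diagonal matrix `diag(e^{iλ}, e^{-iλ})` as an element of `SU(2)`. -/
noncomputable def su2diag (l : ℝ) : SU2 :=
  ⟨⟨Matrix.diagonal ![Complex.exp (l * Complex.I), Complex.exp (-(l * Complex.I))], by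
    rw [Matrix.mem_unitaryGroup_iff]
    rw [Matrix.star_eq_conjTranspose, Matrix.diagonal_conjTranspose,
      Matrix.diagonal_mul_diagonal]
    have h : (fun i => ![Complex.exp (l * Complex.I), Complex.exp (-(l * Complex.I))] i *
        star ![Complex.exp (l * Complex.I), Complex.exp (-(l * Complex.I))] i)
        = (1 : Fin 2 → ℂ) := by
      funext i
      fin_cases i <;>
        simp [Pi.star_apply, ← Complex.exp_conj, ← Complex.exp_add]
    rw [h]; exact Matrix.diagonal_one⟩, by
    rw [mem_SU2_iff]
    rw [Matrix.det_diagonal]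
    simp [Fin.prod_univ_two, ← Complex.exp_add]⟩

/-- The conjugacy class `C(λ)` of `diag(e^{iλ}, e^{-iλ})` in `SU(2)`. -/
noncomputable def conjClass (l : ℝ) : Set SU2 :=
  { g | ∃ h : SU2, h * su2diag l * h⁻¹ = g }

/-- The pointwise set product `C(λ₁)⋯C(λ_m)` of the conjugacy classes
`C(λ₁), …, C(λ_m)` in `SU(2)`. -/
noncomputable def classProd {m : ℕ} (l : Fin m → ℝ) : Set SU2 :=
  (List.ofFn fun i => conjClass (l i)).prod


noncomputable def suM (g : SU2) : Matrix (Fin 2) (Fin 2) ℂ := ((g : Matrix.unitaryGroup (Fin 2) ℂ) : Matrix (Fin 2) (Fin 2) ℂ)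

theorem suM_mul (g h : SU2) : suM (g * h) = suM g * suM h := rfl

theorem suM_inj {g h : SU2} (e : suM g = suM h) : g = h := Subtype.ext (Subtype.ext e)

theorem suM_det (g : SU2) : (suM g).det = 1 := (mem_SU2_iff _).1 g.2

theorem suM_star (g : SU2) : star (suM g) = (suM g).adjugate := by
  have h1 : star (suM g) * suM g = 1 := Matrix.mem_unitaryGroup_iff'.1 g.1.2
  calc star (suM g) = star (suM g) * (suM g * (suM g).adjugate) := by
        rw [Matrix.mul_adjugate, suM_det]; simp
    _ = _ := by rw [← mul_assoc, h1, one_mul]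

theorem suM_11 (g : SU2) : suM g 1 1 = star (suM g 0 0) := by
  have := congrFun (congrFun (suM_star g) 0) 0
  rw [Matrix.adjugate_fin_two] at this
  simpa using this.symm

theorem suM_10 (g : SU2) : suM g 1 0 = - star (suM g 0 1) := by
  have := congrFun (congrFun (suM_star g) 1) 0
  rw [Matrix.adjugate_fin_two] at this
  simp at this
  simp [this]

theorem suM_norm (g : SU2) : normSq (suM g 0 0) + normSq (suM g 0 1) = 1 := by
  have := suM_det g
  rw [Matrix.det_fin_two, suM_11, suM_10] at this
  have h2 := congrArg Complex.re this
  simp at h2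
  simp [normSq_apply]
  linarith

noncomputable def suMk (a b : ℂ) (h : normSq a + normSq b = 1) : SU2 :=
  ⟨⟨!![a, b; -star b, star a], by
    have h' : a * star a + b * star b = 1 := by
      simp only [Complex.star_def, Complex.mul_conj]; exact_mod_cast h
    rw [Matrix.mem_unitaryGroup_iff, Matrix.star_eq_conjTranspose]
    ext i j
    fin_cases i <;> fin_cases j <;> simp [Matrix.mul_apply, Fin.sum_univ_two]
    · exact h'
    · ring
    · ring
    · simp at h'; linear_combination h'⟩, by
    have h' : a * star a + b * star b = 1 := by
      simp only [Complex.star_def, Complex.mul_conj]; exact_mod_cast h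
    rw [mem_SU2_iff]
    simp at h'
    simp [Matrix.det_fin_two]; linear_combination h'⟩

theorem suM_mk (a b : ℂ) (h) : suM (suMk a b h) = !![a, b; -star b, star a] := rfl

theorem suM_diag (l : ℝ) : suM (su2diag l) =
  Matrix.diagonal ![Complex.exp (l * Complex.I), Complex.exp (-(l * Complex.I))] := rfl

noncomputable def suT (g : SU2) : ℝ := (suM g 0 0).re

theorem suT_trace (g : SU2) : (suM g).trace = 2 * (suT g : ℂ) := by
  rw [Matrix.trace_fin_two, suM_11, suT]
  simp [Complex.add_conj]

theorem suT_comm (g h : SU2) : suT (g * h) = suT (h * g) := by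
  have : (2 * (suT (g*h) : ℂ)) = 2 * (suT (h*g) : ℂ) := by
    rw [← suT_trace, ← suT_trace, suM_mul, suM_mul, Matrix.trace_mul_comm]
  exact_mod_cast mul_left_cancel₀ two_ne_zero this

theorem suT_diag (l : ℝ) : suT (su2diag l) = Real.cos l := by
  simp [suT, suM_diag, Complex.exp_ofReal_mul_I_re]

theorem suT_class {l : ℝ} {g : SU2} (h : g ∈ conjClass l) : suT g = Real.cos l := by
  obtain ⟨k, rfl⟩ := h
  rw [suT_comm, ← mul_assoc, inv_mul_cancel, one_mul, suT_diag]

theorem class_of_suT {l : ℝ} {g : SU2} (h : suT g = Real.cos l) : g ∈ conjClass l := by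
  set z := Complex.exp (l * Complex.I) with hz
  have hz1 : Complex.exp (-(l * Complex.I)) = star z := by
    rw [hz, Complex.star_def, ← Complex.exp_conj]; simp
  have hzz : z * star z = 1 := by
    rw [← hz1, hz, ← Complex.exp_add]; simp
  have hzc : z + star z = 2 * (Real.cos l : ℂ) := by
    rw [Complex.star_def, Complex.add_conj, hz, Complex.exp_ofReal_mul_I_re]; simp
  have htr := suT_trace g
  rw [Matrix.trace_fin_two, h, ← hzc] at htr
  have hdet := suM_det g
  rw [Matrix.det_fin_two] at hdet
  have hd : (suM g - z • (1 : Matrix (Fin 2) (Fin 2) ℂ)).det = 0 := by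
    rw [Matrix.det_fin_two]
    simp
    linear_combination hdet - z * htr - hzz
  obtain ⟨v, hv0, hv⟩ := Matrix.exists_mulVec_eq_zero_iff.2 hd
  set r : ℝ := normSq (v 0) + normSq (v 1) with hr
  have hrpos : 0 < r := by
    rcases eq_or_ne (v 0) 0 with h0 | h0
    · have h1 : v 1 ≠ 0 := by
        intro h1; apply hv0; ext i; fin_cases i <;> simp [h0, h1]
      have := normSq_pos.2 h1
      have := normSq_nonneg (v 0)
      linarith
    · have := normSq_pos.2 h0
      have := normSq_nonneg (v 1)
      linarith
  set c : ℂ := (((Real.sqrt r)⁻¹ : ℝ) : ℂ) with hc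
  have hcn : normSq c * r = 1 := by
    rw [hc, normSq_ofReal, ← mul_inv, Real.mul_self_sqrt hrpos.le, inv_mul_cancel₀ hrpos.ne']
  set x := c * v 0 with hx
  set y := c * v 1 with hy
  have hxy : normSq x + normSq (-star y) = 1 := by
    rw [normSq_neg, Complex.star_def, normSq_conj, hx, hy, normSq_mul, normSq_mul, ← mul_add, hcn]
  have e0 := congrFun hv 0
  have e1 := congrFun hv 1
  simp [Matrix.mulVec, dotProduct, Fin.sum_univ_two] at e0 e1
  rw [suM_10, suM_11] at e1
  set a := suM g 0 0 with ha
  set b := suM g 0 1 with hb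
  have f0 : a * x + b * y = z * x := by rw [hx, hy]; linear_combination c * e0
  have f1 : -star b * x + star a * y = z * y := by rw [hx, hy]; linear_combination c * e1
  have f0' := congrArg star f0
  have f1' := congrArg star f1
  refine ⟨suMk x (-star y) hxy, ?_⟩
  rw [mul_inv_eq_iff_eq_mul]
  apply suM_inj
  have hg : suM g = !![a, b; -star b, star a] := by
    ext i j; fin_cases i <;> fin_cases j <;> simp [ha, hb, suM_10, suM_11]
  rw [suM_mul, suM_mul, hg, suM_mk, suM_diag, hz1, ← hz]
  simp at f0' f1' f0 f1
  ext i j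
  fin_cases i <;> fin_cases j <;> simp [Matrix.mul_apply, Fin.sum_univ_two, Matrix.diagonal]
  · linear_combination -f0
  · linear_combination f1'
  · linear_combination -f1
  · linear_combination -f0'

theorem exists_class (g : SU2) : ∃ l ∈ Set.Icc 0 Real.pi, g ∈ conjClass l := by
  have h := suM_norm g
  have h1 := normSq_nonneg (suM g 0 1)
  rw [normSq_apply (suM g 0 0)] at h
  refine ⟨Real.arccos (suT g), ⟨Real.arccos_nonneg _, Real.arccos_le_pi _⟩, class_of_suT ?_⟩
  rw [Real.cos_arccos] <;> unfold suT <;> nlinarith [sq_nonneg (suM g 0 0).im]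

theorem suT_diag_mul (l : ℝ) (g : SU2) : suT (su2diag l * g) =
    Real.cos l * suT g - Real.sin l * (suM g 0 0).im := by
  simp [suT, suM_mul, suM_diag, Matrix.mul_apply, Complex.exp_ofReal_mul_I_re,
    Complex.exp_ofReal_mul_I_im]

theorem triangle_cos {a b c : ℝ} (hb : b ∈ Set.Icc 0 Real.pi) (ha : a ∈ Set.Icc 0 Real.pi)
    {g : SU2} (hg : g ∈ conjClass c) :
    (∃ x ∈ conjClass a, ∃ y ∈ conjClass b, x * y = g) ↔
      Real.cos (a + b) ≤ Real.cos c ∧ Real.cos c ≤ Real.cos (a - b) := by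
  have sa := Real.sin_nonneg_of_mem_Icc ha
  have sb := Real.sin_nonneg_of_mem_Icc hb
  rw [Real.cos_add, Real.cos_sub]
  constructor
  · rintro ⟨x, ⟨k, rfl⟩, y, hy, rfl⟩
    have h1 := suT_class hg
    have h2 : suT (k * su2diag a * k⁻¹ * y) = suT (su2diag a * (k⁻¹ * y * k)) := by
      rw [show k * su2diag a * k⁻¹ * y = k * (su2diag a * k⁻¹ * y) by group, suT_comm]
      congr 1; group
    rw [h2, suT_diag_mul] at h1
    have h3 : suT (k⁻¹ * y * k) = Real.cos b := by
      rw [suT_comm, ← mul_assoc, mul_inv_cancel, one_mul, suT_class hy]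
    have h4 := suM_norm (k⁻¹ * y * k)
    have h5 := normSq_nonneg (suM (k⁻¹ * y * k) 0 1)
    rw [normSq_apply (suM _ 0 0)] at h4
    rw [h3] at h1
    unfold suT at h3
    rw [h3] at h4
    set t := (suM (k⁻¹ * y * k) 0 0).im
    have h6 : t ^ 2 ≤ Real.sin b ^ 2 := by nlinarith [Real.sin_sq_add_cos_sq b]
    have h7 := abs_le.1 (abs_le_of_sq_le_sq h6 sb)
    constructor <;> nlinarith
  · rintro ⟨h1, h2⟩
    obtain ⟨t, ht1, ht2, ht⟩ : ∃ t, -Real.sin b ≤ t ∧ t ≤ Real.sin b ∧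
        Real.cos c = Real.cos a * Real.cos b - Real.sin a * t := by
      rcases sa.eq_or_lt with h0 | h0
      · refine ⟨0, by linarith, by linarith, ?_⟩
        rw [← h0, zero_mul] at h1 h2; rw [← h0]; linarith
      · refine ⟨(Real.cos a * Real.cos b - Real.cos c) / Real.sin a, ?_, ?_, ?_⟩
        · rw [le_div_iff₀ h0]; linarith
        · rw [div_le_iff₀ h0]; linarith
        · field_simp; ring
    have h6 : t ^ 2 ≤ Real.sin b ^ 2 := by nlinarith
    set q := Real.sqrt (Real.sin b ^ 2 - t ^ 2)
    have hq : q * q = Real.sin b ^ 2 - t ^ 2 := Real.mul_self_sqrt (by linarith)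
    have hn : normSq (⟨Real.cos b, t⟩ : ℂ) + normSq (q : ℂ) = 1 := by
      rw [normSq_apply, normSq_ofReal, hq]
      simp only
      linarith [Real.sin_sq_add_cos_sq b]
    set y := suMk ⟨Real.cos b, t⟩ q hn with hy
    have hyT : suT y = Real.cos b := by simp [suT, hy, suM_mk]
    have hT : suT (su2diag a * y) = Real.cos c := by
      rw [suT_diag_mul, hyT, ht]; simp [hy, suM_mk]
    obtain ⟨k, hk⟩ := class_of_suT hT
    obtain ⟨m, hm⟩ := hg
    have e : (m * k⁻¹) * (su2diag a * y) * (m * k⁻¹)⁻¹ = g := by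
      rw [← hk, ← hm]; group
    refine ⟨(m * k⁻¹) * su2diag a * (m * k⁻¹)⁻¹, ⟨_, rfl⟩, (m * k⁻¹) * y * (m * k⁻¹)⁻¹,
      class_of_suT ?_, ?_⟩
    · rw [suT_comm, ← mul_assoc, inv_mul_cancel, one_mul, hyT]
    · rw [← e]; group

theorem cos_le_iff {x y : ℝ} (hx : x ∈ Set.Icc 0 Real.pi) (hy : y ∈ Set.Icc 0 Real.pi) :
    Real.cos x ≤ Real.cos y ↔ y ≤ x := Real.strictAntiOn_cos.le_iff_ge hx hy

theorem triangle {a b c : ℝ} (ha : a ∈ Set.Icc 0 Real.pi) (hb : b ∈ Set.Icc 0 Real.pi)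
    (hc : c ∈ Set.Icc 0 Real.pi) {g : SU2} (hg : g ∈ conjClass c) :
    (∃ x ∈ conjClass a, ∃ y ∈ conjClass b, x * y = g) ↔
      (c ≤ a + b ∧ c ≤ 2 * Real.pi - a - b) ∧ (a - b ≤ c ∧ b - a ≤ c) := by
  rw [triangle_cos hb ha hg]
  obtain ⟨ha0, ha1⟩ := ha
  obtain ⟨hb0, hb1⟩ := hb
  have hc' := hc
  obtain ⟨hc0, hc1⟩ := hc
  apply and_congr
  · rcases le_total (a + b) Real.pi with h | h
    · rw [cos_le_iff ⟨by linarith, h⟩ hc']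
      exact ⟨fun h => ⟨h, by linarith⟩, fun h => h.1⟩
    · rw [← Real.cos_two_pi_sub, cos_le_iff ⟨by linarith, by linarith⟩ hc']
      exact ⟨fun h => ⟨by linarith, by linarith⟩, fun h => by linarith⟩
  · rw [← Real.cos_abs (a - b), cos_le_iff hc' ⟨abs_nonneg _, abs_le.2 ⟨by linarith, by linarith⟩⟩,
      abs_le]
    exact ⟨fun h => ⟨by linarith, by linarith⟩, fun h => ⟨by linarith, by linarith⟩⟩

noncomputable def EO : (m : ℕ) → (Fin m → ℝ) → ℝ × ℝ
  | 0, _ => (0, Real.pi)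
  | m + 1, l =>
    (min (l 0 + (EO m (Fin.tail l)).1) (Real.pi - l 0 + (EO m (Fin.tail l)).2),
     min (l 0 + (EO m (Fin.tail l)).2) (Real.pi - l 0 + (EO m (Fin.tail l)).1))

theorem EO_bounds : ∀ (m : ℕ) (l : Fin m → ℝ), (∀ i, l i ∈ Set.Icc 0 Real.pi) →
    0 ≤ (EO m l).1 ∧ 0 ≤ (EO m l).2 ∧ Real.pi ≤ (EO m l).1 + (EO m l).2
  | 0, _, _ => by simp [EO, Real.pi_pos.le]
  | m + 1, l, hl => by
    obtain ⟨h1, h2, h3⟩ := EO_bounds m (Fin.tail l) (fun i => hl i.succ)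
    obtain ⟨h4, h5⟩ := hl 0
    simp only [EO]
    refine ⟨le_min (by linarith) (by linarith), le_min (by linarith) (by linarith), ?_⟩
    rcases min_choice (l 0 + (EO m (Fin.tail l)).1) (Real.pi - l 0 + (EO m (Fin.tail l)).2) with e | e <;>
    rcases min_choice (l 0 + (EO m (Fin.tail l)).2) (Real.pi - l 0 + (EO m (Fin.tail l)).1) with e' | e' <;>
    rw [e, e'] <;> linarith

theorem suT_one : suT 1 = 1 := by
  have : suM 1 = 1 := rfl
  simp [suT, this]

theorem mem_classProd : ∀ (m : ℕ) (l : Fin m → ℝ), (∀ i, l i ∈ Set.Icc 0 Real.pi) →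
    ∀ (c : ℝ), c ∈ Set.Icc 0 Real.pi → ∀ g ∈ conjClass c,
    (g ∈ classProd l ↔ c ≤ (EO m l).1 ∧ Real.pi - (EO m l).2 ≤ c)
  | 0, l, _, c, hc, g, hg => by
    simp only [classProd, List.ofFn_zero, List.prod_nil, Set.mem_one, EO, sub_self]
    constructor
    · rintro rfl
      have := suT_class hg
      rw [suT_one, ← Real.cos_zero] at this
      have := Real.injOn_cos ⟨le_rfl, Real.pi_pos.le⟩ hc this
      subst this; simp
    · rintro ⟨h1, h2⟩
      obtain rfl : c = 0 := le_antisymm h1 h2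
      obtain ⟨k, rfl⟩ := hg
      have : su2diag 0 = 1 := by
        apply suM_inj
        rw [suM_diag]
        have : suM 1 = 1 := rfl
        rw [this]
        ext i j; fin_cases i <;> fin_cases j <;> simp
      rw [this]; group
  | m + 1, l, hl, c, hc, g, hg => by
    have ih := mem_classProd m (Fin.tail l) (fun i => hl i.succ)
    obtain ⟨b1, b2, b3⟩ := EO_bounds m (Fin.tail l) (fun i => hl i.succ)
    have e : classProd l = conjClass (l 0) * classProd (Fin.tail l) := by
      simp only [classProd, List.ofFn_succ, List.prod_cons]; rfl
    rw [e, Set.mem_mul]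
    have h0 := hl 0
    simp only [EO]
    set E := (EO m (Fin.tail l)).1
    set O := (EO m (Fin.tail l)).2
    obtain ⟨h00, h01⟩ := hl 0
    obtain ⟨hc0, hc1⟩ := hc
    constructor
    · rintro ⟨x, hx, y, hy, hxy⟩
      obtain ⟨b, hb, hyb⟩ := exists_class y
      obtain ⟨⟨t1, t2⟩, t3, t4⟩ := (triangle h0 hb ⟨hc0, hc1⟩ hg).1 ⟨x, hx, y, hyb, hxy⟩
      obtain ⟨i1, i2⟩ := (ih b hb y hyb).1 hy
      refine ⟨le_min (by linarith) (by linarith), ?_⟩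
      rw [sub_le_comm]
      exact le_min (by linarith) (by linarith)
    · rintro ⟨u1, u2⟩
      rw [sub_le_comm, le_min_iff] at u2
      rw [le_min_iff] at u1
      obtain ⟨u1, u3⟩ := u1
      obtain ⟨u2, u4⟩ := u2
      obtain ⟨b, k1, k2, k3, k4, k5, k6, k7, k8⟩ : ∃ b, 0 ≤ b ∧ b ≤ Real.pi ∧ Real.pi - O ≤ b ∧ b ≤ E ∧
          l 0 - c ≤ b ∧ c - l 0 ≤ b ∧ b ≤ l 0 + c ∧ b ≤ 2 * Real.pi - l 0 - c := by
        refine ⟨max (max 0 (Real.pi - O)) (max (l 0 - c) (c - l 0)), ?_, ?_, ?_, ?_, ?_, ?_, ?_, ?_⟩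
        · simp
        · simp only [max_le_iff]; refine ⟨⟨?_, ?_⟩, ?_, ?_⟩ <;> linarith
        · simp
        · simp only [max_le_iff]; refine ⟨⟨?_, ?_⟩, ?_, ?_⟩ <;> linarith
        · simp
        · simp
        · simp only [max_le_iff]; refine ⟨⟨?_, ?_⟩, ?_, ?_⟩ <;> linarith
        · simp only [max_le_iff]; refine ⟨⟨?_, ?_⟩, ?_, ?_⟩ <;> linarith
      obtain ⟨x, hx, y, hy, hxy⟩ := (triangle h0 ⟨k1, k2⟩ ⟨hc0, hc1⟩ hg).2
        ⟨⟨by linarith, by linarith⟩, by linarith, by linarith⟩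
      exact ⟨x, hx, y, (ih b ⟨k1, k2⟩ y hy).2 ⟨k4, k3⟩, hxy⟩

theorem forall_signs {m : ℕ} (P : (Fin (m + 1) → ℝ) → Prop) :
    (∀ ε : Fin (m + 1) → ℝ, (∀ i, ε i = 1 ∨ ε i = -1) → P ε) ↔
    (∀ ε : Fin m → ℝ, (∀ i, ε i = 1 ∨ ε i = -1) → P (Fin.cons (-1) ε)) ∧
    (∀ ε : Fin m → ℝ, (∀ i, ε i = 1 ∨ ε i = -1) → P (Fin.cons 1 ε)) := by
  constructor
  · intro h
    constructor <;> intro ε hε <;> apply h <;> intro i <;> refine Fin.cases ?_ ?_ i <;> simp [hε]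
  · rintro ⟨h1, h2⟩ ε hε
    rw [← Fin.cons_self_tail ε]
    rcases hε 0 with h | h <;> rw [h]
    · exact h2 _ (fun i => hε i.succ)
    · exact h1 _ (fun i => hε i.succ)

theorem EO_iff : ∀ (m : ℕ) (l : Fin m → ℝ), (∀ i, l i ∈ Set.Icc 0 Real.pi) → ∀ x ≤ Real.pi,
    (x ≤ (EO m l).1 ↔ ∀ ε : Fin m → ℝ, (∀ i, ε i = 1 ∨ ε i = -1) → ∏ i, (-ε i) = 1 →
      x ≤ ∑ i, ((1 + ε i) / 2 * Real.pi - ε i * l i)) ∧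
    (x ≤ (EO m l).2 ↔ ∀ ε : Fin m → ℝ, (∀ i, ε i = 1 ∨ ε i = -1) → ∏ i, (-ε i) = -1 →
      x ≤ ∑ i, ((1 + ε i) / 2 * Real.pi - ε i * l i))
  | 0, l, _, x, hx => by
    simp [EO, hx]
    norm_num
  | m + 1, l, hl, x, hx => by
    have ih := EO_iff m (Fin.tail l) (fun i => hl i.succ)
    obtain ⟨h0, h1⟩ := hl 0
    have i1 := ih (x - l 0) (by linarith)
    have i2 := ih (x - (Real.pi - l 0)) (by linarith)
    simp only [EO, le_min_iff]
    rw [forall_signs, forall_signs]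
    simp only [← sub_le_iff_le_add']
    rw [i1.1, i1.2, i2.1, i2.2]
    simp only [Fin.sum_univ_succ, Fin.prod_univ_succ, Fin.cons_zero, Fin.cons_succ, Fin.tail]
    have z1 : (-(-1 : ℝ)) = 1 := by norm_num
    have z2 : ((1 + -1 : ℝ)) / 2 * Real.pi - -1 * l 0 = l 0 := by ring
    have z3 : ((1 + 1 : ℝ)) / 2 * Real.pi - l 0 = Real.pi - l 0 := by ring
    have z4 : ∀ p : ℝ, -1 * p = 1 ↔ p = -1 := fun p => by constructor <;> intro h <;> linarith
    have z5 : ∀ p : ℝ, -1 * p = -1 ↔ p = 1 := fun p => by constructor <;> intro h <;> linarith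
    simp only [z1, z2, z3, z4, z5, one_mul, sub_le_iff_le_add', and_self]

theorem prod_signs {m : ℕ} (ε : Fin m → ℝ) (h : ∀ i, ε i = 1 ∨ ε i = -1) :
    ∏ i, (-ε i) = (-1) ^ (m - (Finset.univ.filter fun i => ε i = -1).card) ∧
    ∑ i, ε i = m - 2 * ((Finset.univ.filter fun i => ε i = -1).card : ℝ) := by
  have e : ∀ i, ε i = 1 - 2 * (if ε i = -1 then 1 else 0) := by
    intro i; rcases h i with h | h <;> rw [h] <;> norm_num
  constructor
  · have e' : ∀ i, -ε i = (if ¬ ε i = -1 then -1 else 1) := by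
      intro i; rcases h i with h | h <;> rw [h] <;> norm_num
    rw [Finset.prod_congr rfl (fun i _ => e' i), ← Finset.prod_filter, Finset.prod_const]
    congr 1
    have := Finset.card_filter_add_card_filter_not (s := (Finset.univ : Finset (Fin m))) (fun i => ε i = -1)
    simp at this
    omega
  · rw [Finset.sum_congr rfl (fun i _ => e i), Finset.sum_sub_distrib, ← Finset.mul_sum]
    simp

/-- For `n ≥ 2` and `λ₁, …, λ_{n+1} ∈ [0, π]`, the identity belongs to
`C(λ₁)⋯C(λ_{n+1})` iff for every `j` with `0 ≤ j ≤ n/2` and every choice of signs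
`ε_i ∈ {1, −1}` with exactly `n − 2j` of them equal to `−1`, one has
`∑ ε_i λ_i ≤ 2jπ`. -/
theorem one_mem_classProd_iff (n : ℕ) (hn : 2 ≤ n) (l : Fin (n + 1) → ℝ)
    (hl : ∀ i, l i ∈ Set.Icc 0 Real.pi) :
    (1 : SU2) ∈ classProd l ↔
      ∀ j : ℕ, 2 * j ≤ n →
        ∀ ε : Fin (n + 1) → ℝ, (∀ i, ε i = 1 ∨ ε i = -1) →
          (Finset.univ.filter fun i => ε i = -1).card = n - 2 * j →
          ∑ i, ε i * l i ≤ 2 * j * Real.pi := by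
  have h1 : (1 : SU2) ∈ conjClass 0 := class_of_suT (by simp [suT_one])
  rw [mem_classProd _ l hl 0 ⟨le_rfl, Real.pi_pos.le⟩ 1 h1]
  have h2 : (0 ≤ (EO (n+1) l).1 ∧ Real.pi - (EO (n+1) l).2 ≤ 0) ↔ Real.pi ≤ (EO (n+1) l).2 :=
    ⟨fun h => by linarith [h.2], fun h => ⟨(EO_bounds _ l hl).1, by linarith⟩⟩
  rw [h2, (EO_iff _ l hl _ le_rfl).2]
  have key : ∀ ε : Fin (n + 1) → ℝ, ∑ i, ((1 + ε i) / 2 * Real.pi - ε i * l i) =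
      ((n : ℝ) + 1 + ∑ i, ε i) / 2 * Real.pi - ∑ i, ε i * l i := by
    intro ε
    rw [Finset.sum_sub_distrib, ← Finset.sum_mul, ← Finset.sum_div, Finset.sum_add_distrib]
    simp
  constructor
  · intro H j hj ε hε hcard
    obtain ⟨p, s⟩ := prod_signs ε hε
    rw [hcard] at p s
    have := H ε hε (by
      rw [p, show n + 1 - (n - 2 * j) = 2 * j + 1 by omega, pow_succ, pow_mul]; simp)
    rw [key, s] at this
    push_cast [Nat.cast_sub hj] at this
    linarith
  · intro H ε hε hp
    obtain ⟨p, s⟩ := prod_signs ε hε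
    set k := (Finset.univ.filter fun i => ε i = -1).card with hk
    have hkle : k ≤ n + 1 := by
      have := Finset.card_le_univ (Finset.univ.filter fun i => ε i = -1)
      simpa using this
    rw [hp] at p
    have hodd : Odd (n + 1 - k) := by
      by_contra hc
      rw [Nat.not_odd_iff_even] at hc
      rw [hc.neg_one_pow] at p
      norm_num at p
    obtain ⟨j, hj⟩ := hodd
    have hj2 : 2 * j ≤ n := by omega
    have hkj : k = n - 2 * j := by omega
    have := H j hj2 ε hε (by rw [← hk, hkj])
    rw [key, s, hkj]
    push_cast [Nat.cast_sub hj2]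
    linarith
end

section
/- Let n ≥ 2 be an integer and λ₁, …, λ_{n+1} ∈ [0, π]. If for every integer j with 0 ≤ j ≤ n/2 and every choice of signs ε₁, …, ε_{n+1} ∈ {+1, −1} with exactly n − 2j of the ε_i equal to −1 one has ∑_{i=1}^{n+1} ε_i λ_i ≤ 2jπ, then the identity matrix I belongs to the set product C(λ₁)⋯C(λ_{n+1}) in SU(2). -/
open Matrix Complex Pointwise

noncomputable def mkSU (a b : ℂ) (h : Complex.normSq a + Complex.normSq b = 1) : SU2 :=
  ⟨⟨!![a, -(starRingEnd ℂ) b; b, (starRingEnd ℂ) a], by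
    have h' : a * (starRingEnd ℂ) a + b * (starRingEnd ℂ) b = 1 := by
      rw [Complex.mul_conj, Complex.mul_conj]; exact_mod_cast h
    rw [Matrix.mem_unitaryGroup_iff, Matrix.star_eq_conjTranspose]
    ext i j
    fin_cases i <;> fin_cases j <;>
      simp [Matrix.mul_apply, Fin.sum_univ_two] <;>
      first | linear_combination h' | ring⟩, by
    have h' : a * (starRingEnd ℂ) a + b * (starRingEnd ℂ) b = 1 := by
      rw [Complex.mul_conj, Complex.mul_conj]; exact_mod_cast h
    rw [mem_SU2_iff]
    simp only [Matrix.det_fin_two_of]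
    linear_combination h'⟩

theorem mkSU_coe (a b : ℂ) (h) : (((mkSU a b h : SU2) : Matrix.unitaryGroup (Fin 2) ℂ) :
    Matrix (Fin 2) (Fin 2) ℂ) = !![a, -(starRingEnd ℂ) b; b, (starRingEnd ℂ) a] := rfl

theorem SU2_ext {g k : SU2} (h : ((g : Matrix.unitaryGroup (Fin 2) ℂ) :
    Matrix (Fin 2) (Fin 2) ℂ) = ((k : Matrix.unitaryGroup (Fin 2) ℂ) :
    Matrix (Fin 2) (Fin 2) ℂ)) : g = k := Subtype.ext (Subtype.ext h)

theorem mkSU_mul {a b c d x y : ℂ} (h₁ h₂ h₃)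
    (hx : x = a * c - (starRingEnd ℂ) b * d) (hy : y = b * c + (starRingEnd ℂ) a * d) :
    mkSU a b h₁ * mkSU c d h₂ = mkSU x y h₃ := by
  apply SU2_ext
  simp only [Subgroup.coe_mul, Submonoid.coe_mul, mkSU_coe]
  subst hx hy
  ext i j
  fin_cases i <;> fin_cases j <;> simp [Matrix.mul_apply, Fin.sum_univ_two] <;> ring

theorem exp_form (y : ℝ) : Complex.exp (y * Complex.I) = ⟨Real.cos y, Real.sin y⟩ := by
  apply Complex.ext
  · simp [Complex.exp_ofReal_mul_I_re]
  · simp [Complex.exp_ofReal_mul_I_im]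

theorem diag_h (y : ℝ) : Complex.normSq ⟨Real.cos y, Real.sin y⟩ + Complex.normSq 0 = 1 := by
  simp [Complex.normSq_mk]
  nlinarith [Real.sin_sq_add_cos_sq y]

theorem su2diag_eq (y : ℝ) : su2diag y = mkSU ⟨Real.cos y, Real.sin y⟩ 0 (diag_h y) := by
  apply SU2_ext
  rw [mkSU_coe]
  have e1 := exp_form y
  have e2 : Complex.exp (-(y * Complex.I)) = (starRingEnd ℂ) ⟨Real.cos y, Real.sin y⟩ := by
    rw [← e1, ← Complex.exp_conj]; simp
  change Matrix.diagonal ![Complex.exp (y * Complex.I), Complex.exp (-(y * Complex.I))] = _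
  rw [e1, e2]
  ext i j
  fin_cases i <;> fin_cases j <;> simp

/-- elements with the right trace are in the class -/
theorem mem_conjClass (y : ℝ) (hy : y ∈ Set.Icc 0 Real.pi) (a b : ℂ) (h)
    (ha : a.re = Real.cos y) : mkSU a b h ∈ conjClass y := by
  have hS := Real.sin_nonneg_of_mem_Icc hy
  have hcs := Real.sin_sq_add_cos_sq y
  suffices ∃ u v : ℂ, ∃ huv : Complex.normSq u + Complex.normSq v = 1,
      a * u - (starRingEnd ℂ) b * v = u * ⟨Real.cos y, Real.sin y⟩ ∧
      b * u + (starRingEnd ℂ) a * v = v * ⟨Real.cos y, Real.sin y⟩ by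
    obtain ⟨u, v, huv, h1, h2⟩ := this
    refine ⟨mkSU u v huv, ?_⟩
    rw [mul_inv_eq_iff_eq_mul, su2diag_eq]
    have h3 : Complex.normSq (u * ⟨Real.cos y, Real.sin y⟩) +
        Complex.normSq (v * ⟨Real.cos y, Real.sin y⟩) = 1 := by
      rw [Complex.normSq_mul, Complex.normSq_mul, ← add_mul, huv]
      simp [Complex.normSq_mk]; nlinarith
    rw [mkSU_mul (x := u * ⟨Real.cos y, Real.sin y⟩) (y := v * ⟨Real.cos y, Real.sin y⟩) _ _ h3
      (by simp) (by simp)]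
    rw [mkSU_mul _ _ h3 h1.symm h2.symm]
  obtain ⟨p, s⟩ := a
  obtain ⟨r, t⟩ := b
  simp only at ha
  subst ha
  generalize Real.cos y = C at *
  generalize Real.sin y = S at *
  simp only [Complex.normSq_mk] at h
  have hq : s ^ 2 + r ^ 2 + t ^ 2 = S ^ 2 := by nlinarith
  by_cases hN : (s + S) ^ 2 + r ^ 2 + t ^ 2 = 0
  · have hr : r = 0 := by nlinarith [sq_nonneg (s+S), sq_nonneg r, sq_nonneg t]
    have ht : t = 0 := by nlinarith [sq_nonneg (s+S), sq_nonneg r, sq_nonneg t]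
    have hs : s = -S := by
      have : s + S = 0 := by nlinarith [sq_nonneg (s+S), sq_nonneg r, sq_nonneg t]
      linarith
    subst hr ht hs
    refine ⟨0, 1, by simp, ?_, ?_⟩
    · apply Complex.ext <;> simp
    · apply Complex.ext <;> simp
  · have hN' : 0 < (s + S) ^ 2 + r ^ 2 + t ^ 2 := lt_of_le_of_ne (by positivity) (Ne.symm hN)
    obtain ⟨k, hk⟩ : ∃ k : ℝ, k ^ 2 * ((s + S) ^ 2 + r ^ 2 + t ^ 2) = 1 := by
      refine ⟨(Real.sqrt ((s + S) ^ 2 + r ^ 2 + t ^ 2))⁻¹, ?_⟩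
      rw [inv_pow, Real.sq_sqrt hN'.le]; field_simp
    refine ⟨⟨0, k * (s + S)⟩, ⟨k * r, k * t⟩, ?_, ?_, ?_⟩
    · simp only [Complex.normSq_mk]; linear_combination hk
    · apply Complex.ext <;> simp <;> first | linear_combination (-k) * hq | ring
    · apply Complex.ext <;> simp <;> ring

theorem exists_s (x c y : ℝ) (hx : x ∈ Set.Icc 0 Real.pi) (hc : c ∈ Set.Icc 0 Real.pi)
    (hy : y ∈ Set.Icc 0 Real.pi) (h1 : x - c ≤ y) (h2 : c - x ≤ y) (h3 : y ≤ x + c)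
    (h4 : y ≤ 2 * Real.pi - x - c) :
    ∃ s : ℝ, s ^ 2 ≤ Real.sin x ^ 2 ∧ Real.cos x * Real.cos c + s * Real.sin c = Real.cos y := by
  obtain ⟨hx0, hx1⟩ := hx
  obtain ⟨hc0, hc1⟩ := hc
  obtain ⟨hy0, hy1⟩ := hy
  have hSx := Real.sin_nonneg_of_nonneg_of_le_pi hx0 hx1
  have hSc := Real.sin_nonneg_of_nonneg_of_le_pi hc0 hc1
  have u : Real.cos y ≤ Real.cos (x - c) := by
    rw [← Real.cos_abs (x - c)]
    exact Real.cos_le_cos_of_nonneg_of_le_pi (abs_nonneg _) hy1 (abs_le.2 ⟨by linarith, by linarith⟩)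
  have l : Real.cos (x + c) ≤ Real.cos y := by
    rcases le_total (x + c) Real.pi with h | h
    · exact Real.cos_le_cos_of_nonneg_of_le_pi hy0 h h3
    · rw [← Real.cos_two_pi_sub (x + c)]
      exact Real.cos_le_cos_of_nonneg_of_le_pi hy0 (by linarith) (by linarith)
  rw [Real.cos_sub] at u
  rw [Real.cos_add] at l
  rcases hSc.eq_or_lt with h0 | hpos
  · refine ⟨0, by nlinarith, ?_⟩
    rw [← h0] at u l ⊢
    linarith
  · refine ⟨(Real.cos y - Real.cos x * Real.cos c) / Real.sin c, ?_, by field_simp; ring⟩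
    apply sq_le_sq'
    · rw [le_div_iff₀ hpos]; linarith
    · rw [div_le_iff₀ hpos]; linarith

theorem su2diag_mem (x c y : ℝ) (hx : x ∈ Set.Icc 0 Real.pi) (hc : c ∈ Set.Icc 0 Real.pi)
    (hy : y ∈ Set.Icc 0 Real.pi) (h1 : x - c ≤ y) (h2 : c - x ≤ y) (h3 : y ≤ x + c)
    (h4 : y ≤ 2 * Real.pi - x - c) : su2diag c ∈ conjClass x * conjClass y := by
  obtain ⟨s, hs, he⟩ := exists_s x c y hx hc hy h1 h2 h3 h4
  set r := Real.sqrt (Real.sin x ^ 2 - s ^ 2) with hr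
  have hr2 : r ^ 2 = Real.sin x ^ 2 - s ^ 2 := Real.sq_sqrt (by linarith)
  have hcs := Real.sin_sq_add_cos_sq x
  have hcc := Real.sin_sq_add_cos_sq c
  have hg : Complex.normSq ⟨Real.cos x, s⟩ + Complex.normSq ⟨r, 0⟩ = 1 := by
    simp only [Complex.normSq_mk]; linear_combination hr2 + hcs
  have hk : Complex.normSq (⟨Real.cos x, -s⟩ * ⟨Real.cos c, Real.sin c⟩) +
      Complex.normSq (⟨-r, 0⟩ * ⟨Real.cos c, Real.sin c⟩) = 1 := by
    rw [Complex.normSq_mul, Complex.normSq_mul, ← add_mul]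
    simp only [Complex.normSq_mk]
    have e1 : Real.cos x * Real.cos x + -s * -s + (-r * -r + 0 * 0) = 1 := by
      linear_combination hr2 + hcs
    rw [e1]; linear_combination hcc
  rw [Set.mem_mul]
  refine ⟨_, mem_conjClass x hx _ _ hg rfl, _, mem_conjClass y hy _ _ hk ?_, ?_⟩
  · simp; linarith
  · rw [su2diag_eq]
    apply mkSU_mul
    · apply Complex.ext <;> simp
      · linear_combination (-Real.cos c) * (hr2 + hcs)
      · linear_combination (-Real.sin c) * (hr2 + hcs)
    · apply Complex.ext <;> simp <;> ring

theorem conjClass_conj_mem (x : ℝ) (g h : SU2) (hg : g ∈ conjClass x) : h * g * h⁻¹ ∈ conjClass x := by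
  obtain ⟨k, rfl⟩ := hg
  exact ⟨h * k, by group⟩

theorem conjClass_sub (x c y : ℝ) (hx : x ∈ Set.Icc 0 Real.pi) (hc : c ∈ Set.Icc 0 Real.pi)
    (hy : y ∈ Set.Icc 0 Real.pi) (h1 : x - c ≤ y) (h2 : c - x ≤ y) (h3 : y ≤ x + c)
    (h4 : y ≤ 2 * Real.pi - x - c) : conjClass c ⊆ conjClass x * conjClass y := by
  rintro _ ⟨h, rfl⟩
  obtain ⟨g, hg, k, hk, e⟩ := Set.mem_mul.1 (su2diag_mem x c y hx hc hy h1 h2 h3 h4)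
  refine Set.mem_mul.2 ⟨_, conjClass_conj_mem x g h hg, _, conjClass_conj_mem y k h hk, ?_⟩
  rw [← e]; group

theorem one_mem_conjClass : conjClass 0 = {1} := by
  have : su2diag 0 = 1 := by
    apply SU2_ext
    change Matrix.diagonal _ = (1 : Matrix (Fin 2) (Fin 2) ℂ)
    ext i j
    fin_cases i <;> fin_cases j <;> simp
  ext g
  simp [conjClass, this, eq_comm]

theorem classProd_main (m : ℕ) : ∀ (l : Fin m → ℝ), (∀ i, l i ∈ Set.Icc 0 Real.pi) →
    ∃ lo hi : ℝ, lo ≤ hi ∧ lo ≤ Real.pi ∧ 0 ≤ hi ∧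
      (∀ c ∈ Set.Icc 0 Real.pi, lo ≤ c → c ≤ hi → conjClass c ⊆ classProd l) ∧
      (lo ≤ -∑ i, l i ∨ ∃ b : Fin m → Bool, Odd (∑ i, if b i then 1 else 0 : ℕ) ∧
        lo ≤ (∑ i, if b i then l i - Real.pi else - l i) + Real.pi) ∧
      (∃ b : Fin m → Bool, Even (∑ i, if b i then 1 else 0 : ℕ) ∧
        - (∑ i, if b i then l i - Real.pi else - l i) ≤ hi) := by
  have hpi := Real.pi_pos
  induction m with
  | zero =>
    intro l _
    refine ⟨0, 0, le_rfl, hpi.le, le_rfl, ?_, by simp, ⟨fun _ => false, by simp⟩⟩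
    intro c _ h1 h2
    obtain rfl : c = 0 := le_antisymm h2 h1
    rw [one_mem_conjClass]
    simp [classProd]
  | succ m ih =>
    intro l hl
    obtain ⟨lo, hi, h1, h2, h3, h4, h5, h6⟩ := ih (fun i => l i.succ) (fun i => hl _)
    obtain ⟨b, hbe, hb⟩ := h6
    obtain ⟨x0, x1⟩ := hl 0
    refine ⟨max (lo - l 0) (l 0 - hi), min (hi + l 0) (2 * Real.pi - lo - l 0), ?_, ?_, ?_, ?_,
      ?_, ?_⟩
    · apply le_min <;> apply max_le <;> linarith
    · apply max_le <;> linarith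
    · apply le_min <;> linarith
    · intro c hc c1 c2
      obtain ⟨c3, c4⟩ := max_le_iff.1 c1
      obtain ⟨c5, c6⟩ := le_min_iff.1 c2
      obtain ⟨hc0, hc1⟩ := hc
      have e : classProd l = conjClass (l 0) * classProd (fun i => l i.succ) := by
        simp [classProd, List.ofFn_succ]
      set y := max lo (max (l 0 - c) (c - l 0)) with hy
      have y1 : lo ≤ y := le_max_left _ _
      have y2 : l 0 - c ≤ y := le_trans (le_max_left _ _) (le_max_right _ _)
      have y3 : c - l 0 ≤ y := le_trans (le_max_right _ _) (le_max_right _ _)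
      have y4 : y ≤ hi := by
        refine max_le h1 (max_le ?_ ?_) <;> linarith
      have y5 : y ≤ l 0 + c := by
        refine max_le ?_ (max_le ?_ ?_) <;> linarith
      have y6 : y ≤ 2 * Real.pi - l 0 - c := by
        refine max_le ?_ (max_le ?_ ?_) <;> linarith
      have hyI : y ∈ Set.Icc 0 Real.pi := ⟨by linarith, by linarith⟩
      rw [e]
      exact (conjClass_sub (l 0) c y ⟨x0, x1⟩ ⟨hc0, hc1⟩ hyI y2 y3 y5 y6).trans
        (Set.mul_subset_mul_left (h4 y hyI y1 y4))
    · rcases le_total (lo - l 0) (l 0 - hi) with h | h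
      · rw [max_eq_right h]
        right
        refine ⟨Fin.cons true b, ?_, ?_⟩
        · simp only [Fin.sum_univ_succ, Fin.cons_zero, Fin.cons_succ, if_true]
          rw [add_comm]; exact hbe.add_one
        · simp only [Fin.sum_univ_succ, Fin.cons_zero, Fin.cons_succ, if_true]
          linarith
      · rw [max_eq_left h]
        rcases h5 with h5 | ⟨b', hbo, hb'⟩
        · left
          rw [Fin.sum_univ_succ]; linarith
        · right
          refine ⟨Fin.cons false b', ?_, ?_⟩
          · simp only [Fin.sum_univ_succ, Fin.cons_zero, Fin.cons_succ, Bool.false_eq_true, if_false, zero_add]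
            exact hbo
          · simp only [Fin.sum_univ_succ, Fin.cons_zero, Fin.cons_succ, Bool.false_eq_true, if_false]
            linarith
    · rcases le_total (hi + l 0) (2 * Real.pi - lo - l 0) with h | h
      · rw [min_eq_left h]
        refine ⟨Fin.cons false b, ?_, ?_⟩
        · simp only [Fin.sum_univ_succ, Fin.cons_zero, Fin.cons_succ, Bool.false_eq_true, if_false, zero_add]
          exact hbe
        · simp only [Fin.sum_univ_succ, Fin.cons_zero, Fin.cons_succ, Bool.false_eq_true, if_false]
          linarith
      · rw [min_eq_right h]
        rcases h5 with h5 | ⟨b', hbo, hb'⟩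
        · refine ⟨fun _ => false, by simp, ?_⟩
          simp only [Fin.sum_univ_succ, Bool.false_eq_true, if_false, Finset.sum_neg_distrib]
          linarith
        · refine ⟨Fin.cons true b', ?_, ?_⟩
          · simp only [Fin.sum_univ_succ, Fin.cons_zero, Fin.cons_succ, if_true]
            rw [add_comm]; exact hbo.add_one
          · simp only [Fin.sum_univ_succ, Fin.cons_zero, Fin.cons_succ, if_true]
            linarith

/-- For `n ≥ 2` and `λ₁, …, λ_{n+1} ∈ [0, π]`, if for every `j` with
`0 ≤ j ≤ n/2` and every choice of signs `ε_i ∈ {1, −1}` with exactly `n − 2j` of them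
equal to `−1` one has `∑ ε_i λ_i ≤ 2jπ`, then the identity belongs to
`C(λ₁)⋯C(λ_{n+1})`. -/
theorem one_mem_classProd_sufficient (n : ℕ) (hn : 2 ≤ n) (l : Fin (n + 1) → ℝ)
    (hl : ∀ i, l i ∈ Set.Icc 0 Real.pi)
    (hineq : ∀ j : ℕ, 2 * j ≤ n →
      ∀ ε : Fin (n + 1) → ℝ, (∀ i, ε i = 1 ∨ ε i = -1) →
        (Finset.univ.filter fun i => ε i = -1).card = n - 2 * j →
        ∑ i, ε i * l i ≤ 2 * j * Real.pi) :
    (1 : SU2) ∈ classProd l := by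
  obtain ⟨lo, hi, -, -, h3, h4, h5, -⟩ := classProd_main (n + 1) l hl
  have key : lo ≤ 0 := by
    rcases h5 with h5 | ⟨b, ⟨j, hj⟩, hb⟩
    · have := Finset.sum_nonneg (fun i (_ : i ∈ Finset.univ) => (hl i).1)
      linarith
    · have hcard : (Finset.univ.filter fun i => b i = true).card = 2 * j + 1 := by
        rw [← hj, Finset.card_filter]
      have htot := Finset.card_filter_add_card_filter_not (s := (Finset.univ : Finset (Fin (n+1))))
        (fun i => b i = true)
      simp only [Finset.card_univ, Fintype.card_fin] at htot
      have h := hineq j (by omega) (fun i => if b i then 1 else -1)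
        (fun i => by by_cases h : b i <;> simp [h]) (by
          have : (Finset.univ.filter fun i => (if b i then (1:ℝ) else -1) = -1) =
              Finset.univ.filter fun i => ¬ b i = true := by
            ext i
            by_cases h : b i <;> simp [h]
            norm_num
          rw [this]; omega)
      have e : (∑ i, if b i then l i - Real.pi else - l i) =
          (∑ i, (if b i then (1:ℝ) else -1) * l i) - (2 * j + 1) * Real.pi := by
        have hj' : ((∑ i, if b i then 1 else 0 : ℕ) : ℝ) = 2 * j + 1 := by
          rw [hj]; push_cast; ring
        rw [← hj']
        push_cast
        rw [Finset.sum_mul, ← Finset.sum_sub_distrib]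
        refine Finset.sum_congr rfl fun i _ => ?_
        by_cases h : b i <;> simp [h]
      rw [e] at hb
      linarith
  have := h4 0 ⟨le_rfl, Real.pi_pos.le⟩ key h3
  rw [one_mem_conjClass] at this
  exact this rfl
end

section
/- For λ₁, λ₂ ∈ [0, π], the set product C(λ₁)C(λ₂) equals all of SU(2) if and only if λ₁ = λ₂ = π/2. -/
open Matrix Complex Pointwise

noncomputable def su2mk (a b : ℂ) (h : a * star a + b * star b = 1) : SU2 :=
  ⟨⟨!![a, b; -star b, star a], by
    rw [Matrix.mem_unitaryGroup_iff]
    ext i j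
    fin_cases i <;> fin_cases j <;>
      simp [Matrix.mul_apply, Fin.sum_univ_two, Matrix.star_apply] <;>
      simp at h <;> first | linear_combination h | ring⟩, by
    rw [mem_SU2_iff, Matrix.det_fin_two_of]
    linear_combination h⟩

theorem su2_ext {x y : SU2} (h : (x.1.1 : Matrix (Fin 2) (Fin 2) ℂ) = y.1.1) : x = y :=
  Subtype.ext (Subtype.ext h)

theorem su2_form (g : SU2) : ∃ a b : ℂ, ∃ h : a * star a + b * star b = 1, g = su2mk a b h := by
  obtain ⟨⟨M, hu⟩, hd⟩ := g
  rw [mem_SU2_iff] at hd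
  simp only at hd
  have hs : star M = M.adjugate := by
    have h1 := Matrix.mem_unitaryGroup_iff'.1 hu
    have h2 := Matrix.mul_adjugate M
    rw [hd, one_smul] at h2
    calc star M = star M * (M * M.adjugate) := by rw [h2, mul_one]
      _ = M.adjugate := by rw [← mul_assoc, h1, one_mul]
  rw [Matrix.adjugate_fin_two] at hs
  have e0 : star (M 0 0) = M 1 1 := by simpa [Matrix.star_apply] using congrFun₂ hs 0 0
  have e1 : star (M 0 1) = - M 1 0 := by simpa [Matrix.star_apply] using congrFun₂ hs 1 0
  rw [Matrix.det_fin_two] at hd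
  refine ⟨M 0 0, M 0 1, ?_, ?_⟩
  · rw [e0, e1]; linear_combination hd
  · apply su2_ext
    ext i j
    fin_cases i <;> fin_cases j <;> simp only [su2mk] <;> simp [-star_def, e0, e1]

theorem diag_half : ((su2diag (Real.pi / 2)).1.1 : Matrix (Fin 2) (Fin 2) ℂ) = !![I, 0; 0, -I] := by
  have : Complex.exp (((Real.pi / 2 : ℝ) : ℂ) * I) = I := by
    push_cast; exact Complex.exp_pi_div_two_mul_I
  ext i j
  fin_cases i <;> fin_cases j <;> simp only [su2diag, Complex.exp_neg, this] <;> simp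

theorem mem_half (t : ℝ) (w : ℂ) (h) : su2mk (t * I) w h ∈ conjClass (Real.pi / 2) := by
  have h' := h
  simp only [star_def, map_mul, conj_ofReal, conj_I, mul_conj] at h'
  have hr : t ^ 2 + normSq w = 1 := by
    have : ((t ^ 2 + normSq w : ℝ) : ℂ) = 1 := by
      push_cast; linear_combination h' + t ^ 2 * I_mul_I
    exact_mod_cast this
  suffices ∃ k : SU2, k * su2diag (Real.pi / 2) = su2mk (t * I) w h * k by
    obtain ⟨k, hk⟩ := this
    exact ⟨k, by rw [hk]; group⟩
  by_cases ht : t = -1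
  · have hw : w = 0 := by
      rw [← normSq_eq_zero]; rw [ht] at hr; linarith
    subst hw ht
    refine ⟨su2mk 0 1 (by simp), su2_ext ?_⟩
    simp only [Subgroup.coe_mul, Submonoid.coe_mul, diag_half]
    simp [su2mk]
  · have hn := normSq_nonneg w
    have hp : 0 < 2 + 2 * t := by
      have : -1 ≤ t := by nlinarith
      have := lt_of_le_of_ne this (Ne.symm ht)
      linarith
    obtain ⟨s, hs0, hs⟩ : ∃ s : ℝ, s ≠ 0 ∧ s ^ 2 * (2 + 2 * t) = 1 :=
      ⟨(Real.sqrt (2 + 2 * t))⁻¹, by positivity, by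
        rw [inv_pow, Real.sq_sqrt hp.le]; exact inv_mul_cancel₀ hp.ne'⟩
    have hsC : (s : ℂ) ^ 2 * (2 + 2 * t) = 1 := by exact_mod_cast hs
    have hrC : (t : ℂ) ^ 2 + w * star w = 1 := by
      rw [star_def, mul_conj]; exact_mod_cast hr
    have hI := I_mul_I
    refine ⟨su2mk (s * ((1 + t) * I)) (s * w) ?_, su2_ext ?_⟩
    · simp only [star_def, map_mul, map_add, map_one, conj_ofReal, conj_I] at hrC ⊢
      linear_combination hsC + (s : ℂ) ^ 2 * hrC - (s : ℂ) ^ 2 * (1 + t) ^ 2 * hI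
    · simp only [Subgroup.coe_mul, Submonoid.coe_mul, diag_half]
      simp only [star_def] at hrC
      ext i j
      fin_cases i <;> fin_cases j <;> simp [su2mk, Matrix.mul_apply, Fin.sum_univ_two]
      · linear_combination (s : ℂ) * hrC + (s : ℂ) * (1 - t ^ 2) * hI
      · ring
      · ring
      · linear_combination (s : ℂ) * hrC + (s : ℂ) * (1 - t ^ 2) * hI

theorem trace_class {l : ℝ} {x : SU2} (h : x ∈ conjClass l) :
    Matrix.trace (x.1.1 : Matrix (Fin 2) (Fin 2) ℂ) = 2 * Complex.cos l := by
  obtain ⟨k, rfl⟩ := h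
  have e : ((k⁻¹ : SU2).1.1 * k.1.1 : Matrix (Fin 2) (Fin 2) ℂ) = 1 := by
    have := congrArg (fun z : SU2 => (z.1.1 : Matrix (Fin 2) (Fin 2) ℂ)) (inv_mul_cancel k)
    simp only [Subgroup.coe_mul, Submonoid.coe_mul] at this
    exact this
  simp only [Subgroup.coe_mul, Submonoid.coe_mul]
  rw [Matrix.trace_mul_comm, ← mul_assoc, e, one_mul, Complex.two_cos]
  simp [su2diag, Matrix.trace, Fin.sum_univ_two]

/-- For `λ₁, λ₂ ∈ [0, π]`, the set product `C(λ₁)C(λ₂)` equals all of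
`SU(2)` iff `λ₁ = λ₂ = π/2`. -/
theorem two_classProd_eq_univ_iff (l₁ l₂ : ℝ)
    (h₁ : l₁ ∈ Set.Icc 0 Real.pi) (h₂ : l₂ ∈ Set.Icc 0 Real.pi) :
    conjClass l₁ * conjClass l₂ = Set.univ ↔
      l₁ = Real.pi / 2 ∧ l₂ = Real.pi / 2 := by
  constructor
  · intro H
    have key : ∀ e : ℂ, star e = e → ∀ h : e * star e + 0 * star 0 = 1,
        Complex.cos l₂ = e * Complex.cos l₁ := by
      intro e he h
      obtain ⟨x, hx, y, hy, hxy⟩ : su2mk e 0 h ∈ conjClass l₁ * conjClass l₂ := by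
        rw [H]; trivial
      simp only at hxy
      have tx := trace_class hx
      have ty := trace_class hy
      obtain rfl : y = x⁻¹ * su2mk e 0 h := by rw [← hxy]; group
      obtain ⟨a, b, hab, rfl⟩ := su2_form x
      have hi : (su2mk a b hab)⁻¹ = su2mk (star a) (-b) (by
        rw [star_star, star_neg]; linear_combination hab) := by
        rw [inv_eq_iff_mul_eq_one]
        apply su2_ext
        simp only [Subgroup.coe_mul, Submonoid.coe_mul]
        simp only [star_def] at hab
        ext i j
        fin_cases i <;> fin_cases j <;> simp [su2mk, Matrix.mul_apply, Fin.sum_univ_two]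
        · linear_combination hab
        · ring
        · ring
        · linear_combination hab
      rw [hi] at ty
      simp only [Subgroup.coe_mul, Submonoid.coe_mul] at ty
      simp [su2mk, Matrix.trace, Fin.sum_univ_two, Matrix.mul_apply, -star_def, he] at tx ty
      linear_combination (e * tx - ty) / 2
    have k1 := key 1 (by simp) (by simp)
    have k2 := key (-1) (by simp) (by simp)
    have c1 : Complex.cos l₁ = 0 := by linear_combination (k2 - k1) / 2
    have c2 : Complex.cos l₂ = 0 := by linear_combination (k2 + k1) / 2
    have fin : ∀ l ∈ Set.Icc 0 Real.pi, Complex.cos (l : ℝ) = 0 → l = Real.pi / 2 := by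
      intro l hl h
      have h' : Real.cos l = 0 := by exact_mod_cast h
      apply Real.injOn_cos hl ⟨by positivity, by linarith [Real.pi_pos]⟩
      rw [h', Real.cos_pi_div_two]
    exact ⟨fin _ h₁ c1, fin _ h₂ c2⟩
  · rintro ⟨rfl, rfl⟩
    rw [Set.eq_univ_iff_forall]
    intro g
    obtain ⟨a, b, hab, rfl⟩ := su2_form g
    obtain ⟨w, hw, r, hr⟩ : ∃ w : ℂ, w * star w = 1 ∧ ∃ r : ℝ, w * star b = r * I := by
      refine ⟨I * Complex.exp (b.arg * I), ?_, ‖b‖, ?_⟩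
      · simp [← Complex.exp_conj, mul_mul_mul_comm, ← Complex.exp_add]
      · have hb : star b = ‖b‖ * Complex.exp (-(b.arg * I)) := by
          conv_lhs => rw [← Complex.norm_mul_exp_arg_mul_I b]
          rw [star_def, map_mul, ← Complex.exp_conj, map_mul, conj_ofReal, conj_ofReal, conj_I,
            mul_neg]
        rw [hb]
        have : Complex.exp (b.arg * I) * Complex.exp (-(b.arg * I)) = 1 := by
          rw [← Complex.exp_add]; simp
        linear_combination (‖b‖ : ℂ) * I * this
    have hx := mem_half 0 w (by simpa using hw)
    have hy := mem_half r (-(w * star a)) (by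
      rw [← hr]; simp only [star_neg, star_mul, star_star]
      linear_combination (w * star w) * hab + hw)
    refine ⟨_, hx, _, hy, su2_ext ?_⟩
    have hr' : star w * b = - (r * I) := by
      have := congrArg star hr
      simp at this
      simpa [mul_comm] using this
    simp only [Subgroup.coe_mul, Submonoid.coe_mul]
    simp only [star_def] at hw hr hr'
    ext i j
    fin_cases i <;> fin_cases j <;> simp [su2mk, Matrix.mul_apply, Fin.sum_univ_two]
    · linear_combination a * hw
    · linear_combination -w * hr' + b * hw
    · linear_combination -(starRingEnd ℂ) w * hr + (starRingEnd ℂ) b * hw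
    · linear_combination (starRingEnd ℂ) a * hw
end
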